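/- Let N ≥ 3, λ > 0, p > 1. Suppose v ∈ C²(0,b) satisfies v'' + ((N-1)/r)v' + λv + v^p = 0 and v(r) > 0 for all r ∈ (0,b). Then v'(r) < 0 for all r ∈ (0,b). -/

import Mathlib

open Real Filter Set

/-- A function on a right neighbourhood of `0` whose derivative is at least `d / r ^ 2` with
`d > 0` cannot stay positive. -/
lemma exists_nonpos_of_div_sq_le_deriv {v v' : ℝ → ℝ} {s d : ℝ} (hs : 0 < s) (hd : 0 < d)
    (hv : ∀ r ∈ Ioc 0 s, HasDerivAt v (v' r) r) (hle : ∀ r ∈ Ioc 0 s, d / r ^ 2 ≤ v' r) :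
    ∃ r ∈ Ioc 0 s, v r ≤ 0 := by
  by_contra! hpos
  have hder : ∀ r ∈ Ioc 0 s, HasDerivAt (fun x => v x + d * x⁻¹) (v' r + d * -(r ^ 2)⁻¹) r :=
    fun r hr => (hv r hr).add ((hasDerivAt_inv hr.1.ne').const_mul d)
  have hmono : MonotoneOn (fun x => v x + d * x⁻¹) (Ioc 0 s) := by
    refine monotoneOn_of_deriv_nonneg (convex_Ioc 0 s)
      (fun r hr => (hder r hr).continuousAt.continuousWithinAt)
      (fun r hr => (hder r (interior_subset hr)).differentiableAt.differentiableWithinAt)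
      fun r hr => ?_
    rw [(hder r (interior_subset hr)).deriv]
    have := hle r (interior_subset hr)
    rw [div_eq_mul_inv] at this
    linarith
  have hs' : s ∈ Ioc 0 s := ⟨hs, le_rfl⟩
  have hvs := hpos s hs'
  have hr : (v s / d + s⁻¹)⁻¹ ∈ Ioc 0 s :=
    ⟨by positivity, inv_le_of_inv_le₀ hs (by linarith [div_pos hvs hd])⟩
  have h1 := hmono hr hs' hr.2
  have h2 := hpos _ hr
  simp only [inv_inv, mul_add, mul_div_cancel₀ _ hd.ne'] at h1
  linarith

theorem stmt_10 (N : ℕ) (hN : 3 ≤ N) (lam : ℝ) (hlam : 0 < lam) (p : ℝ) (hp : 1 < p)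
    (b : ℝ) (hb : 0 < b) (v : ℝ → ℝ) (hv : ContDiffOn ℝ 2 v (Set.Ioo 0 b))
    (heqv : ∀ r ∈ Set.Ioo (0:ℝ) b,
      deriv (deriv v) r + (((N:ℝ) - 1) / r) * deriv v r + lam * v r + (v r) ^ p = 0)
    (hvpos : ∀ r ∈ Set.Ioo (0:ℝ) b, 0 < v r) :
    ∀ r ∈ Set.Ioo (0:ℝ) b, deriv v r < 0 := by
  obtain ⟨n, rfl⟩ := Nat.exists_eq_add_of_le' hN
  have hdv : ∀ r ∈ Ioo 0 b, HasDerivAt v (deriv v r) r := fun r hr =>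
    ((hv.differentiableOn (by norm_num)).differentiableAt (isOpen_Ioo.mem_nhds hr)).hasDerivAt
  have hdv' : ∀ r ∈ Ioo 0 b, HasDerivAt (deriv v) (deriv (deriv v) r) r := fun r hr =>
    (((hv.deriv_of_isOpen (m := 1) isOpen_Ioo (by norm_num)).differentiableOn
      (by norm_num)).differentiableAt (isOpen_Ioo.mem_nhds hr)).hasDerivAt
  have hdw : ∀ r ∈ Ioo 0 b, HasDerivAt (fun x => x ^ (n + 2) * deriv v x)
      (-(r ^ (n + 2) * (lam * v r + v r ^ p))) r := fun r hr => by
    refine ((hasDerivAt_pow (n + 2) r).mul (hdv' r hr)).congr_deriv ?_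
    have h0 : r ≠ 0 := hr.1.ne'
    have h := heqv r hr
    have h2 : lam * v r + v r ^ p
        = -(deriv (deriv v) r + ((((n + 3 : ℕ) : ℝ) - 1) / r) * deriv v r) := by linarith
    rw [h2]
    push_cast
    field_simp
    ring
  have hanti : StrictAntiOn (fun x => x ^ (n + 2) * deriv v x) (Ioo 0 b) := by
    refine strictAntiOn_of_deriv_neg (convex_Ioo 0 b)
      (fun r hr => (hdw r hr).continuousAt.continuousWithinAt) fun r hr => ?_
    have hr := interior_subset hr
    rw [(hdw r hr).deriv]
    have := hvpos r hr
    have := hr.1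
    exact neg_neg_of_pos (by positivity)
  intro r hr
  by_contra! hnn
  have hr0 := hr.1
  have hs : 0 < r / 2 := by linarith
  have hsub : ∀ x ∈ Ioc 0 (r / 2), x ∈ Ioo 0 b := fun x hx => ⟨hx.1, by linarith [hx.2, hr.2]⟩
  have hs' := hsub _ ⟨hs, le_rfl⟩
  set s := r / 2 with hsdef
  have hc : 0 < s ^ (n + 2) * deriv v s :=
    lt_of_le_of_lt (by positivity) (hanti hs' hr (by linarith))
  have hd : 0 < s ^ 2 * deriv v s := by
    have := pos_of_mul_pos_right hc (by positivity)
    positivity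
  obtain ⟨x, hx, hvx⟩ := exists_nonpos_of_div_sq_le_deriv hs hd
    (fun x hx => hdv x (hsub x hx)) fun x hx => by
      have hx0 := hx.1
      have h1 : s ^ (n + 2) * deriv v s ≤ x ^ (n + 2) * deriv v x :=
        hanti.antitoneOn (hsub x hx) hs' hx.2
      have h2 : 0 < deriv v x := pos_of_mul_pos_right (hc.trans_le h1) (by positivity)
      rw [div_le_iff₀ (by positivity)]
      have h3 : x ^ n ≤ s ^ n := pow_le_pow_left₀ hx0.le hx.2 n
      have h4 : x ^ n * (x ^ 2 * deriv v x) ≤ s ^ n * (x ^ 2 * deriv v x) := by gcongr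
      refine le_of_mul_le_mul_left (a := s ^ n) ?_ (by positivity)
      calc s ^ n * (s ^ 2 * deriv v s) = s ^ (n + 2) * deriv v s := by ring
        _ ≤ x ^ (n + 2) * deriv v x := h1
        _ = x ^ n * (x ^ 2 * deriv v x) := by ring
        _ ≤ s ^ n * (x ^ 2 * deriv v x) := h4
        _ = s ^ n * (deriv v x * x ^ 2) := by ring
  exact (hvpos x (hsub x hx)).not_ge hvx
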